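/- Let Ω⁺ ⊂ ℝ³ be a bounded open set with |Ω⁺| = m > 0, let λ > 0, and let u ∈ L¹(ℝ³) with 0 ≤ u ≤ 1 a.e., u = 0 a.e. on Ω⁺, and ∫_{ℝ³} u ≤ λ. Then the potential φ(x) := ∫_{ℝ³} (χ_{Ω⁺}(y) − u(y))/(4π|x−y|) dy satisfies −(1/2)(3λ/(4π))^{2/3} ≤ φ(x) ≤ (1/2)(3m/(4π))^{2/3} for all x ∈ ℝ³, and |φ(x)| → 0 as |x| → ∞. -/

import Mathlib

open MeasureTheory Real Filter

noncomputable section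

abbrev E3 := EuclideanSpace ℝ (Fin 3)

/-- The Coulomb kernel in ℝ³. -/
def coul (x y : E3) : ℝ := 1 / (4 * π * ‖x - y‖)

/-- The potential generated by the charge density `χ_{Ω⁺} − u`. -/
def potentialU (Ωp : Set E3) (u : E3 → ℝ) (x : E3) : ℝ :=
  ∫ y, (Set.indicator Ωp (fun _ => (1:ℝ)) y - u y) * coul x y

/-- The Coulomb kernel cut off to a ball, as a function of the distance. -/
def coulProfile (R : ℝ) : ℝ → ℝ := (Set.Iio R).indicator fun r => 1 / (4 * π * r)

lemma coul_nonneg (x y : E3) : 0 ≤ coul x y := by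
  unfold coul; positivity

lemma measurable_coul (x : E3) : Measurable (coul x) := by
  unfold coul; fun_prop

lemma indicator_ball_coul (x : E3) (R : ℝ) (y : E3) :
    (Metric.ball x R).indicator (coul x) y = coulProfile R ‖x - y‖ := by
  have h : y ∈ Metric.ball x R ↔ ‖x - y‖ < R := by
    rw [Metric.mem_ball, dist_comm, dist_eq_norm]
  classical
  rw [coulProfile, Set.indicator_apply, Set.indicator_apply]
  simp only [h, Set.mem_Iio, coul]

lemma radial_coulProfile (R : ℝ) :
    Set.EqOn (fun r : ℝ => r ^ (Module.finrank ℝ E3 - 1) • coulProfile R r)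
      ((Set.Iio R).indicator fun r => r / (4 * π)) (Set.Ioi 0) := by
  intro r (hr : 0 < r)
  simp only [finrank_euclideanSpace, Fintype.card_fin, smul_eq_mul, coulProfile,
    Set.indicator_apply]
  split_ifs
  · field_simp
  · simp

lemma integrable_indicator_ball_coul (x : E3) (R : ℝ) :
    Integrable ((Metric.ball x R).indicator (coul x)) := by
  have h : Integrable (fun z : E3 => coulProfile R ‖z‖) := by
    rw [integrable_fun_norm_addHaar,
      integrableOn_congr_fun (radial_coulProfile R) measurableSet_Ioi]
    rw [IntegrableOn, integrable_indicator_iff measurableSet_Iio, IntegrableOn,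
      Measure.restrict_restrict measurableSet_Iio]
    have hc : IntegrableOn (fun r : ℝ => r / (4 * π)) (Set.Icc 0 R) :=
      (by fun_prop : Continuous fun r : ℝ => r / (4 * π)).continuousOn.integrableOn_Icc
    exact hc.mono_set fun r hr => ⟨le_of_lt hr.2, le_of_lt hr.1⟩
  rw [funext (indicator_ball_coul x R)]
  exact h.comp_sub_left x

lemma volume_real_ball (x : E3) {R : ℝ} (hR : 0 ≤ R) :
    volume.real (Metric.ball x R) = 4 * π / 3 * R ^ 3 := by
  rw [Measure.real, EuclideanSpace.volume_ball_fin_three, ENNReal.toReal_mul, ENNReal.toReal_pow,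
    ENNReal.toReal_ofReal hR, ENNReal.toReal_ofReal (by positivity)]
  ring

lemma integral_indicator_ball_coul (x : E3) {R : ℝ} (hR : 0 ≤ R) :
    ∫ y, (Metric.ball x R).indicator (coul x) y = R ^ 2 / 2 := by
  simp_rw [indicator_ball_coul]
  rw [integral_sub_left_eq_self (fun z : E3 => coulProfile R ‖z‖) volume x,
    integral_fun_norm_addHaar, setIntegral_congr_fun measurableSet_Ioi (radial_coulProfile R),
    setIntegral_indicator measurableSet_Iio, Set.Ioi_inter_Iio, ← integral_Ioc_eq_integral_Ioo,
    ← intervalIntegral.integral_of_le hR, intervalIntegral.integral_div, integral_id,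
    volume_real_ball 0 zero_le_one]
  simp only [finrank_euclideanSpace, Fintype.card_fin, nsmul_eq_mul, smul_eq_mul]
  field_simp
  norm_num

lemma le_coul_of_mem_ball {x y : E3} {R : ℝ} (hy : y ∈ Metric.ball x R) (hxy : y ≠ x) :
    1 / (4 * π * R) ≤ coul x y := by
  have h : 0 < ‖x - y‖ := norm_pos_iff.2 (sub_ne_zero.2 hxy.symm)
  rw [Metric.mem_ball, dist_comm, dist_eq_norm] at hy
  unfold coul
  gcongr

lemma coul_le_of_notMem_ball {x y : E3} {R : ℝ} (hR : 0 < R) (hy : y ∉ Metric.ball x R) :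
    coul x y ≤ 1 / (4 * π * R) := by
  rw [Metric.mem_ball, not_lt, dist_comm, dist_eq_norm] at hy
  unfold coul
  gcongr

lemma integral_density_mul_coul_nonneg {f : E3 → ℝ} (h01 : ∀ᵐ y, 0 ≤ f y ∧ f y ≤ 1) (x : E3) :
    0 ≤ ∫ y, f y * coul x y := by
  refine integral_nonneg_of_ae ?_
  filter_upwards [h01] with y hy using mul_nonneg hy.1 (coul_nonneg x y)

lemma integrable_density_mul_coul {f : E3 → ℝ} (hf : Integrable f)
    (h01 : ∀ᵐ y, 0 ≤ f y ∧ f y ≤ 1) (x : E3) :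
    Integrable fun y => f y * coul x y := by
  refine ((integrable_indicator_ball_coul x 1).add (hf.const_mul (1 / (4 * π * 1)))).mono'
    (hf.aestronglyMeasurable.mul (measurable_coul x).aestronglyMeasurable) ?_
  filter_upwards [h01] with y hy
  have hk := coul_nonneg x y
  rw [Real.norm_of_nonneg (mul_nonneg hy.1 hk), Pi.add_apply]
  by_cases hb : y ∈ Metric.ball x 1
  · rw [Set.indicator_of_mem hb]
    have : 0 ≤ 1 / (4 * π * 1) * f y := mul_nonneg (by positivity) hy.1
    nlinarith
  · rw [Set.indicator_of_notMem hb]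
    nlinarith [coul_le_of_notMem_ball one_pos hb]

/-- The bathtub principle for the Coulomb kernel: among densities with values in `[0, 1]` and given
mass, the potential at `x` is largest for the ball centred at `x`. -/
lemma integral_density_mul_coul_le {f : E3 → ℝ} (hf : Integrable f)
    (h01 : ∀ᵐ y, 0 ≤ f y ∧ f y ≤ 1)
    {M : ℝ} (hM : 0 < M) (hfM : ∫ y, f y ≤ M) (x : E3) :
    ∫ y, f y * coul x y ≤ 1 / 2 * (3 * M / (4 * π)) ^ ((2 : ℝ) / 3) := by
  set A : ℝ := 3 * M / (4 * π) with hA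
  have hA0 : 0 < A := by positivity
  set R : ℝ := A ^ ((1 : ℝ) / 3) with hRdef
  have hR : 0 < R := by positivity
  have hR3 : R ^ 3 = A := by
    rw [hRdef, ← Real.rpow_natCast, ← Real.rpow_mul hA0.le]; norm_num
  have hR2 : A ^ ((2 : ℝ) / 3) = R ^ 2 := by
    rw [hRdef, ← Real.rpow_natCast, ← Real.rpow_mul hA0.le]; norm_num
  have hball : volume.real (Metric.ball x R) = M := by
    rw [volume_real_ball x hR.le, hR3, hA]; field_simp
  have hone : Integrable ((Metric.ball x R).indicator fun _ => (1 : ℝ)) :=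
    (integrable_indicator_iff measurableSet_ball).2
      (integrableOn_const measure_ball_lt_top.ne)
  have hone' : ∫ y, (Metric.ball x R).indicator (fun _ => (1 : ℝ)) y = M := by
    rw [integral_indicator measurableSet_ball, setIntegral_const, hball, smul_eq_mul, mul_one]
  have hK := integrable_indicator_ball_coul x R
  have hD : Integrable fun y =>
      1 / (4 * π * R) * (f y - (Metric.ball x R).indicator (fun _ => (1 : ℝ)) y) :=
    (hf.sub hone).const_mul _
  calc ∫ y, f y * coul x y
      ≤ ∫ y, ((Metric.ball x R).indicator (coul x) y +
          1 / (4 * π * R) * (f y - (Metric.ball x R).indicator (fun _ => (1 : ℝ)) y)) := by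
        refine integral_mono_ae (integrable_density_mul_coul hf h01 x) (hK.add hD) ?_
        filter_upwards [h01, Measure.ae_ne volume x] with y hy hyx
        by_cases hb : y ∈ Metric.ball x R
        · simp only [Set.indicator_of_mem hb]
          nlinarith [le_coul_of_mem_ball hb hyx]
        · simp only [Set.indicator_of_notMem hb]
          nlinarith [coul_le_of_notMem_ball hR hb]
    _ = R ^ 2 / 2 + 1 / (4 * π * R) * ((∫ y, f y) - M) := by
        rw [integral_add hK hD, integral_const_mul, integral_sub hf hone, hone',
          integral_indicator_ball_coul x hR.le]
    _ ≤ 1 / 2 * A ^ ((2 : ℝ) / 3) := by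
        have : 0 ≤ 1 / (4 * π * R) := by positivity
        rw [hR2]
        nlinarith

lemma tendsto_integral_density_mul_coul {f : E3 → ℝ} (hf : Integrable f)
    (h01 : ∀ᵐ y, 0 ≤ f y ∧ f y ≤ 1) :
    Tendsto (fun x => ∫ y, f y * coul x y) (Bornology.cobounded E3) (nhds 0) := by
  have : (Bornology.cobounded E3).IsCountablyGenerated := by
    rw [← comap_norm_atTop]; infer_instance
  have far (R : ℝ) (hR : 0 < R) :
      Tendsto (fun x => ∫ y, f y * min (coul x y) (1 / (4 * π * R))) (Bornology.cobounded E3)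
        (nhds 0) := by
    rw [← integral_zero E3 ℝ (μ := volume)]
    refine tendsto_integral_filter_of_dominated_convergence
      (fun y => 1 / (4 * π * R) * f y) ?_ ?_ (hf.const_mul _) ?_
    · exact .of_forall fun x => hf.aestronglyMeasurable.mul
        ((measurable_coul x).min measurable_const).aestronglyMeasurable
    · refine .of_forall fun x => ?_
      filter_upwards [h01] with y hy
      have h0 : 0 ≤ min (coul x y) (1 / (4 * π * R)) :=
        le_min (coul_nonneg x y) (by positivity)
      rw [Real.norm_of_nonneg (mul_nonneg hy.1 h0), mul_comm]
      exact mul_le_mul_of_nonneg_right (min_le_right _ _) hy.1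
    · refine .of_forall fun y => ?_
      have hk : Tendsto (fun x => coul x y) (Bornology.cobounded E3) (nhds 0) := by
        have h : Tendsto (fun x : E3 => ‖x - y‖) (Bornology.cobounded E3) atTop :=
          tendsto_norm_cobounded_atTop.comp (tendsto_sub_const_cobounded y)
        exact (h.const_mul_atTop (by positivity : 0 < 4 * π)).const_div_atTop 1
      have hm := hk.min (tendsto_const_nhds (x := 1 / (4 * π * R)))
      rw [min_eq_left (by positivity)] at hm
      simpa using hm.const_mul (f y)
  have near (R : ℝ) (hR : 0 < R) (x : E3) :
      ∫ y, f y * coul x y ≤ R ^ 2 / 2 + ∫ y, f y * min (coul x y) (1 / (4 * π * R)) := by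
    have hK := integrable_indicator_ball_coul x R
    have hI := integrable_density_mul_coul hf h01 x
    have hmin : Integrable fun y => f y * min (coul x y) (1 / (4 * π * R)) := by
      refine hI.mono' (hf.aestronglyMeasurable.mul
        ((measurable_coul x).min measurable_const).aestronglyMeasurable) ?_
      filter_upwards [h01] with y hy
      have h0 : 0 ≤ min (coul x y) (1 / (4 * π * R)) :=
        le_min (coul_nonneg x y) (by positivity)
      rw [Real.norm_of_nonneg (mul_nonneg hy.1 h0)]
      exact mul_le_mul_of_nonneg_left (min_le_left _ _) hy.1
    rw [← integral_indicator_ball_coul x hR.le, ← integral_add hK hmin]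
    refine integral_mono_ae hI (hK.add hmin) ?_
    filter_upwards [h01] with y hy
    have hk := coul_nonneg x y
    by_cases hb : y ∈ Metric.ball x R
    · simp only [Set.indicator_of_mem hb]
      have h0 : 0 ≤ f y * min (coul x y) (1 / (4 * π * R)) :=
        mul_nonneg hy.1 (le_min hk (by positivity))
      nlinarith
    · simp only [Set.indicator_of_notMem hb,
        min_eq_left (coul_le_of_notMem_ball hR hb), zero_add, le_refl]
  rw [tendsto_order]
  refine ⟨fun a ha => .of_forall fun x =>
    ha.trans_le (integral_density_mul_coul_nonneg h01 x), fun ε hε => ?_⟩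
  have hR : 0 < √ε := Real.sqrt_pos.2 hε
  filter_upwards [(far _ hR).eventually_lt_const (half_pos hε)] with x hx
  have := near _ hR x
  rw [Real.sq_sqrt hε.le] at this
  linarith

/-- **Lemma 3.1** (Bounds and decay of the potential): for an admissible relaxed
density `u`, the potential satisfies the explicit two-sided bound and vanishes
at infinity. -/
theorem potential_bounds_and_decay
    (Ωp : Set E3) (ho : IsOpen Ωp) (hb : Bornology.IsBounded Ωp)
    (m : ℝ) (hm : 0 < m) (hvol : volume Ωp = ENNReal.ofReal m)
    (lam : ℝ) (hlam : 0 < lam)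
    (u : E3 → ℝ) (hint : Integrable u)
    (h01 : ∀ᵐ x, 0 ≤ u x ∧ u x ≤ 1)
    (h0 : ∀ᵐ x, x ∈ Ωp → u x = 0)
    (hmass : ∫ x, u x ≤ lam) :
    (∀ x, -(1/2) * (3 * lam / (4 * π)) ^ ((2:ℝ)/3) ≤ potentialU Ωp u x ∧
      potentialU Ωp u x ≤ (1/2) * (3 * m / (4 * π)) ^ ((2:ℝ)/3)) ∧
    Tendsto (fun x => |potentialU Ωp u x|) (Bornology.cobounded E3) (nhds 0) := by
  set χ : E3 → ℝ := Set.indicator Ωp (fun _ => (1 : ℝ)) with hχ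
  have hχint : Integrable χ :=
    (integrable_indicator_iff ho.measurableSet).2 (integrableOn_const (by simp [hvol]))
  have hχmass : ∫ y, χ y = m := by
    rw [hχ, integral_indicator ho.measurableSet, setIntegral_const, Measure.real, hvol,
      ENNReal.toReal_ofReal hm.le, smul_eq_mul, mul_one]
  have hχ01 : ∀ᵐ y, 0 ≤ χ y ∧ χ y ≤ 1 := .of_forall fun y => by
    by_cases hy : y ∈ Ωp <;> simp [hχ, hy]
  have hsplit (x : E3) :
      potentialU Ωp u x = (∫ y, χ y * coul x y) - ∫ y, u y * coul x y := by
    simp only [potentialU, sub_mul]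
    exact integral_sub (integrable_density_mul_coul hχint hχ01 x)
      (integrable_density_mul_coul hint h01 x)
  refine ⟨fun x => ?_, ?_⟩
  · rw [hsplit]
    have h1 := integral_density_mul_coul_nonneg hχ01 x
    have h2 := integral_density_mul_coul_nonneg h01 x
    have h3 := integral_density_mul_coul_le hχint hχ01 hm hχmass.le x
    have h4 := integral_density_mul_coul_le hint h01 hlam hmass x
    constructor <;> linarith
  · simp_rw [hsplit]
    simpa using ((tendsto_integral_density_mul_coul hχint hχ01).sub
      (tendsto_integral_density_mul_coul hint h01)).abs
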